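/- The range of the function Γ_m on many-one degrees is exactly [0, 1/2] ∪ {1}: for every r ∈ [0, 1/2] there is a many-one degree 𝐚 with Γ_m(𝐚) = r, Γ_m of the degree of computable sets is 1, and no many-one degree has Γ_m strictly between 1/2 and 1. -/

import Mathlib

open Filter Set

/-- Lower (asymptotic) density of a set of naturals. -/
noncomputable def lowerDensity (Z : Set ℕ) : ℝ :=
  Filter.liminf (fun n => ((Z ∩ Set.Iio n).ncard : ℝ) / n) Filter.atTop

/-- Upper (asymptotic) density of a set of naturals. -/
noncomputable def upperDensity (Z : Set ℕ) : ℝ :=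
  Filter.limsup (fun n => ((Z ∩ Set.Iio n).ncard : ℝ) / n) Filter.atTop

/-- The agreement set `A ↔ R`. -/
def agree (A R : Set ℕ) : Set ℕ := {x | x ∈ A ↔ x ∈ R}

/-- The coarse computability bound `γ(A)`. -/
noncomputable def ccGamma (A : Set ℕ) : ℝ :=
  sSup {r | ∃ R : Set ℕ, ComputablePred (· ∈ R) ∧ r = lowerDensity (agree A R)}

/-- The coarse computability bound of the many-one degree of `A`. -/
noncomputable def GammaM (A : Set ℕ) : ℝ :=
  sInf {r | ∃ B : Set ℕ, (· ∈ B) ≤₀ (· ∈ A) ∧ r = ccGamma B}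

open MeasureTheory ProbabilityTheory in
theorem ae_sum_lt {Ω : Type*} [MeasurableSpace Ω] (μ : Measure Ω) [IsProbabilityMeasure μ]
    (X : ℕ → Ω → ℝ) (hi : iIndepFun X μ) (hs : ∀ i, HasSubgaussianMGF (X i) (1/4) μ)
    (T : ℕ → Finset ℕ) (hT : ∀ N, (T N).card ≤ N) (δ : ℝ) (hδ : 0 < δ) :
    ∀ᵐ ω ∂μ, ∀ᶠ N : ℕ in atTop, ∑ i ∈ T N, X i ω < δ * N := by
  have key : ∀ N : ℕ, μ {ω | δ * N ≤ ∑ i ∈ T N, X i ω} ≤ ENNReal.ofReal (Real.exp (-2 * δ^2) ^ N) := by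
    intro N
    rw [← ENNReal.ofReal_toReal (measure_ne_top μ _)]
    apply ENNReal.ofReal_le_ofReal
    change μ.real _ ≤ _
    rcases Nat.eq_zero_or_pos N with h0 | h0
    · subst h0
      simp
    have hN : (0:ℝ) < N := by exact_mod_cast h0
    rcases (T N).eq_empty_or_nonempty with h1 | h1
    · have : {ω | δ * N ≤ ∑ i ∈ T N, X i ω} = ∅ := by
        ext ω
        simp [h1]
        positivity
      rw [this]
      simp
      positivity
    · refine (HasSubgaussianMGF.measure_sum_ge_le_of_iIndepFun hi (fun i _ => hs i)
        (by positivity)).trans ?_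
      rw [← Real.exp_nat_mul]
      apply Real.exp_le_exp.2
      have hc : (0:ℝ) < (T N).card := by exact_mod_cast h1.card_pos
      have hc' : ((T N).card : ℝ) ≤ N := by exact_mod_cast hT N
      simp only [Finset.sum_const, nsmul_eq_mul]
      push_cast
      rw [div_le_iff₀ (by positivity)]
      have : 0 ≤ δ^2 * N * (N - (T N).card) := by
        have := sub_nonneg.2 hc'
        positivity
      nlinarith
  have hsum : ∑' N, μ {ω | δ * N ≤ ∑ i ∈ T N, X i ω} ≠ ⊤ := by
    refine ne_top_of_le_ne_top ?_ (ENNReal.tsum_le_tsum key)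
    have hs : Summable (fun N : ℕ => Real.exp (-2 * δ^2) ^ N) := by
      apply summable_geometric_of_lt_one (by positivity)
      rw [← Real.exp_zero]
      apply Real.exp_lt_exp.2
      nlinarith [sq_pos_of_pos hδ]
    exact hs.tsum_ofReal_ne_top
  filter_upwards [ae_eventually_notMem hsum] with ω hω
  filter_upwards [hω] with N hN
  simpa using hN

open MeasureTheory ProbabilityTheory in
theorem exists_random {J : Type*} [Countable J] (r : ℝ) (h0 : 0 ≤ r) (h1 : r ≤ 1)
    (T : J → ℕ → Finset ℕ) (hT : ∀ j N, (T j N).card ≤ N) :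
    ∃ E : ℕ → Bool, ∀ j, ∀ ε > (0:ℝ), ∀ᶠ N : ℕ in atTop,
      |∑ i ∈ T j N, ((if E i then (1:ℝ) else 0) - r)| ≤ ε * N := by
  let p : Measure Bool := bernoulliMeasure true false ⟨r, h0, h1⟩
  let μ : Measure (ℕ → Bool) := Measure.infinitePi (fun _ => p)
  let Y : Bool → ℝ := fun b => if b then (1:ℝ) else 0
  have hY : Measurable Y := measurable_from_top
  have hint : ∫ b, Y b ∂p = r := by
    rw [integral_bernoulliMeasure]
    simp [Y]
  let X : ℕ → (ℕ → Bool) → ℝ := fun i ω => Y (ω i) - r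
  have hi : iIndepFun X μ :=
    iIndepFun_infinitePi (P := fun _ => p) (X := fun _ b => Y b - r)
      (fun _ => measurable_from_top)
  have hs : ∀ i, HasSubgaussianMGF (X i) (1/4) μ := by
    intro i
    have hm : Measurable (fun ω : ℕ → Bool => Y (ω i)) := hY.comp (measurable_pi_apply i)
    have := hasSubgaussianMGF_of_mem_Icc (μ := μ) (X := fun ω => Y (ω i)) (a := 0) (b := 1)
      hm.aemeasurable (by
        refine Filter.Eventually.of_forall fun ω => ?_
        simp only [Y]
        split_ifs <;> simp)
    have e : ∫ ω, Y (ω i) ∂μ = r := by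
      rw [← hint]
      have h := Measure.infinitePi_map_eval (fun _ : ℕ => p) i
      rw [← h, integral_map (measurable_pi_apply i).aemeasurable hY.aestronglyMeasurable]
    rw [e] at this
    convert this using 1
    norm_num
  have hae : ∀ᵐ ω ∂μ, ∀ j, ∀ k : ℕ, ∀ᶠ N : ℕ in atTop,
      |∑ i ∈ T j N, X i ω| ≤ (1 / ((k:ℝ) + 1)) * N := by
    rw [ae_all_iff]; intro j
    rw [ae_all_iff]; intro k
    have hk : (0:ℝ) < 1 / ((k:ℝ) + 1) := by positivity
    have a := ae_sum_lt μ X hi hs (T j) (hT j) _ hk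
    have b := ae_sum_lt μ (fun i ω => - X i ω) (hi.comp (fun _ x => -x) (fun _ => measurable_neg))
      (fun i => (hs i).neg) (T j) (hT j) _ hk
    filter_upwards [a, b] with ω ha hb
    filter_upwards [ha, hb] with N hNa hNb
    rw [Finset.sum_neg_distrib] at hNb
    rw [abs_le]
    constructor <;> linarith
  obtain ⟨E, hE⟩ := hae.exists
  refine ⟨E, fun j ε hε => ?_⟩
  obtain ⟨k, hk⟩ := exists_nat_one_div_lt hε
  filter_upwards [hE j k] with N hN
  refine hN.trans ?_
  gcongr

/-! ### Basic facts on densities -/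

theorem ncard_Iio_le (Z : Set ℕ) (n : ℕ) : (Z ∩ Set.Iio n).ncard ≤ n := by
  have := Set.ncard_le_ncard (Set.inter_subset_right : Z ∩ Set.Iio n ⊆ Set.Iio n)
    (Set.finite_Iio n)
  simpa using this

theorem ratio_nonneg (Z : Set ℕ) (n : ℕ) : (0:ℝ) ≤ ((Z ∩ Set.Iio n).ncard : ℝ) / n := by
  positivity

theorem ratio_le_one (Z : Set ℕ) (n : ℕ) : ((Z ∩ Set.Iio n).ncard : ℝ) / n ≤ 1 := by
  apply div_le_one_of_le₀ _ (by positivity)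
  exact_mod_cast ncard_Iio_le Z n

theorem ratio_bdd_ge (Z : Set ℕ) :
    IsBoundedUnder (· ≥ ·) atTop (fun n : ℕ => ((Z ∩ Set.Iio n).ncard : ℝ) / n) :=
  isBoundedUnder_of ⟨0, fun n => ratio_nonneg Z n⟩

theorem ratio_bdd_le (Z : Set ℕ) :
    IsBoundedUnder (· ≤ ·) atTop (fun n : ℕ => ((Z ∩ Set.Iio n).ncard : ℝ) / n) :=
  isBoundedUnder_of ⟨1, fun n => ratio_le_one Z n⟩

theorem le_lowerDensity (Z : Set ℕ) (c : ℝ)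
    (h : ∀ ε > (0:ℝ), ∀ᶠ n : ℕ in atTop, (c - ε) * n ≤ ((Z ∩ Set.Iio n).ncard : ℝ)) :
    c ≤ lowerDensity Z := by
  apply le_of_forall_sub_le
  intro ε hε
  apply le_liminf_of_le (ratio_bdd_le Z).isCoboundedUnder_ge
  filter_upwards [h ε hε, eventually_gt_atTop 0] with n hn h0
  rw [le_div_iff₀ (by exact_mod_cast h0)]
  exact hn

theorem eventually_of_lt_lowerDensity (Z : Set ℕ) (c : ℝ) (h : c < lowerDensity Z) :
    ∀ᶠ n : ℕ in atTop, c * n < ((Z ∩ Set.Iio n).ncard : ℝ) := by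
  filter_upwards [eventually_lt_of_lt_liminf h (ratio_bdd_ge Z), eventually_gt_atTop 0] with n hn h0
  rwa [lt_div_iff₀ (by exact_mod_cast h0)] at hn

theorem lowerDensity_nonneg (Z : Set ℕ) : 0 ≤ lowerDensity Z :=
  le_liminf_of_le (ratio_bdd_le Z).isCoboundedUnder_ge
    (Eventually.of_forall fun n => ratio_nonneg Z n)

theorem lowerDensity_le_one (Z : Set ℕ) : lowerDensity Z ≤ 1 := by
  by_contra! h
  obtain ⟨n, hn⟩ := (eventually_of_lt_lowerDensity Z 1 h).exists
  have : ((Z ∩ Set.Iio n).ncard : ℝ) ≤ n := by exact_mod_cast ncard_Iio_le Z n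
  linarith

theorem lowerDensity_univ : lowerDensity Set.univ = 1 := by
  apply le_antisymm (lowerDensity_le_one _)
  apply le_lowerDensity
  intro ε hε
  refine Eventually.of_forall fun n => ?_
  simp
  nlinarith [(Nat.cast_nonneg n : (0:ℝ) ≤ n)]

theorem le_ccGamma (A R : Set ℕ) (hR : ComputablePred (· ∈ R)) :
    lowerDensity (agree A R) ≤ ccGamma A := by
  apply le_csSup
  · refine ⟨1, ?_⟩
    rintro _ ⟨R, _, rfl⟩
    exact lowerDensity_le_one _
  · exact ⟨R, hR, rfl⟩

theorem computablePred_empty : ComputablePred (· ∈ (∅ : Set ℕ)) :=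
  ComputablePred.computable_iff.2 ⟨fun _ => false, Computable.const false, by ext; simp⟩

theorem ccGamma_le (A : Set ℕ) (c : ℝ)
    (h : ∀ R : Set ℕ, ComputablePred (· ∈ R) → lowerDensity (agree A R) ≤ c) :
    ccGamma A ≤ c := by
  apply csSup_le
  · exact ⟨_, ∅, computablePred_empty, rfl⟩
  · rintro _ ⟨R, hR, rfl⟩
    exact h R hR

theorem ccGamma_nonneg (A : Set ℕ) : 0 ≤ ccGamma A :=
  (lowerDensity_nonneg _).trans (le_ccGamma A ∅ computablePred_empty)

theorem GammaM_le (A B : Set ℕ) (h : (· ∈ B) ≤₀ (· ∈ A)) : GammaM A ≤ ccGamma B := by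
  apply csInf_le
  · refine ⟨0, ?_⟩
    rintro _ ⟨B, _, rfl⟩
    exact ccGamma_nonneg B
  · exact ⟨B, h, rfl⟩

theorem le_GammaM (A : Set ℕ) (c : ℝ)
    (h : ∀ B : Set ℕ, (· ∈ B) ≤₀ (· ∈ A) → c ≤ ccGamma B) : c ≤ GammaM A := by
  apply le_csInf
  · exact ⟨_, A, manyOneReducible_refl _, rfl⟩
  · rintro _ ⟨B, hB, rfl⟩
    exact h B hB

theorem ccGamma_of_computable (A : Set ℕ) (h : ComputablePred (· ∈ A)) : ccGamma A = 1 := by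
  apply le_antisymm
  · exact ccGamma_le _ _ fun R _ => lowerDensity_le_one _
  · have := le_ccGamma A A h
    have e : agree A A = Set.univ := by ext; simp [agree]
    rwa [e, lowerDensity_univ] at this

theorem GammaM_of_computable (A : Set ℕ) (h : ComputablePred (· ∈ A)) : GammaM A = 1 := by
  apply le_antisymm
  · rw [← ccGamma_of_computable A h]
    exact GammaM_le A A (manyOneReducible_refl _)
  · apply le_GammaM
    intro B hB
    rw [ccGamma_of_computable B (ComputablePred.computable_of_manyOneReducible hB h)]

/-! ### Factorial blocks -/

/-- index of the factorial block containing `x` -/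
def blk (x : ℕ) : ℕ := Nat.findGreatest (fun n => n.factorial ≤ x) x

theorem blk_eq (n x : ℕ) (h1 : n.factorial ≤ x) (h2 : x < (n + 1).factorial) : blk x = n := by
  rw [blk, Nat.findGreatest_eq_iff]
  refine ⟨(Nat.self_le_factorial n).trans h1, fun _ => h1, fun k hk _ => ?_⟩
  have := Nat.factorial_le (Nat.succ_le_of_lt hk)
  rw [Nat.succ_eq_add_one] at this
  omega

theorem primrec_factorial : Primrec Nat.factorial := by
  have : Primrec (fun n : ℕ => Nat.rec (motive := fun _ => ℕ) 1 (fun k ih => (k + 1) * ih) n) := by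
    refine Primrec.nat_rec' (f := fun n : ℕ => n) (g := fun _ => 1)
      (h := fun _ q => (q.1 + 1) * q.2) Primrec.id (Primrec.const 1) ?_
    exact (Primrec.nat_mul.comp (Primrec.succ.comp (Primrec.fst.comp Primrec.snd))
      (Primrec.snd.comp Primrec.snd)).to₂
  refine this.of_eq fun n => ?_
  induction n with
  | zero => rfl
  | succ k ih => simp only [Nat.factorial_succ]; rw [← ih]

theorem computable_blk : Computable blk := by
  apply Primrec.to_comp
  refine Primrec.nat_findGreatest (p := fun x n => n.factorial ≤ x) Primrec.id ?_
  exact Primrec.nat_le.comp (primrec_factorial.comp Primrec.snd) Primrec.fst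

/-- initial counting function of a boolean sequence -/
def cnt (f : ℕ → Bool) (n : ℕ) : ℕ :=
  Nat.rec (motive := fun _ => ℕ) 0 (fun k ih => ih + cond (f k) 1 0) n

theorem computable_cnt (f : ℕ → Bool) (hf : Computable f) : Computable (cnt f) := by
  refine Computable.nat_rec (f := fun n : ℕ => n) (g := fun _ => 0)
    (h := fun _ p => p.2 + cond (f p.1) 1 0) Computable.id (Computable.const 0) ?_
  have h1 : Computable (fun q : ℕ × (ℕ × ℕ) => cond (f q.2.1) 1 0) :=
    Computable.cond (hf.comp (Computable.fst.comp Computable.snd)) (Computable.const 1)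
      (Computable.const 0)
  exact (Primrec.nat_add.to_comp.comp (Computable.snd.comp Computable.snd) h1).to₂

theorem ncard_succ (Z : Set ℕ) [DecidablePred (· ∈ Z)] (n : ℕ) :
    (Z ∩ Set.Iio (n + 1)).ncard = (Z ∩ Set.Iio n).ncard + if n ∈ Z then 1 else 0 := by
  split_ifs with h
  · have : Z ∩ Set.Iio (n + 1) = insert n (Z ∩ Set.Iio n) := by
      ext x
      simp only [Set.mem_inter_iff, Set.mem_Iio, Set.mem_insert_iff]
      constructor
      · rintro ⟨a, b⟩
        rcases Nat.lt_succ_iff_lt_or_eq.1 b with c | c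
        · exact Or.inr ⟨a, c⟩
        · exact Or.inl c
      · rintro (rfl | ⟨a, b⟩)
        · exact ⟨h, by omega⟩
        · exact ⟨a, by omega⟩
    rw [this, Set.ncard_insert_of_notMem (by simp) ((Set.finite_Iio n).inter_of_right _)]
  · have : Z ∩ Set.Iio (n + 1) = Z ∩ Set.Iio n := by
      ext x
      simp only [Set.mem_inter_iff, Set.mem_Iio]
      constructor
      · rintro ⟨a, b⟩
        rcases Nat.lt_succ_iff_lt_or_eq.1 b with c | c
        · exact ⟨a, c⟩
        · subst c; exact absurd a h
      · rintro ⟨a, b⟩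
        exact ⟨a, by omega⟩
    rw [this, add_zero]

theorem cnt_eq (f : ℕ → Bool) (n : ℕ) : cnt f n = ({x | f x = true} ∩ Set.Iio n).ncard := by
  induction n with
  | zero => simp [cnt]
  | succ k ih =>
    rw [ncard_succ, ← ih]
    change cnt f k + _ = _
    by_cases h : f k = true <;> simp [h]

theorem computable_of_eventually (A : Set ℕ) (F : ℕ → Bool) (hF : Computable F) (n0 : ℕ)
    (h : ∀ n ≥ n0, (n ∈ A ↔ F n = true)) : ComputablePred (· ∈ A) := by
  classical
  let L : List Bool := (List.range n0).map (fun n => decide (n ∈ A))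
  refine ComputablePred.computable_iff.2 ⟨fun n => (L[n]?).getD (F n), ?_, ?_⟩
  · exact Primrec.option_getD.to_comp.comp (Primrec.list_getElem?₁ L).to_comp hF
  · ext n
    by_cases hn : n < n0
    · simp [L, hn]
    · simp [L, hn, h n (by omega)]

theorem ccGamma_blowup (A : Set ℕ) (hA : ¬ ComputablePred (· ∈ A)) :
    ccGamma {x | blk x ∈ A} ≤ 1 / 2 := by
  apply ccGamma_le
  intro R hR
  by_contra! hlt
  apply hA
  obtain ⟨c, hc1, hc2⟩ := exists_between hlt
  have hev := eventually_of_lt_lowerDensity _ c hc2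
  obtain ⟨f, hf, hfR⟩ := ComputablePred.computable_iff.1 hR
  have hRf : R = {x | f x = true} := by
    ext x
    exact iff_of_eq (congrFun hfR x)
  have ht : Tendsto (fun n : ℕ => (n + 1).factorial) atTop atTop :=
    tendsto_atTop_mono (fun n => (Nat.le_succ n).trans (Nat.self_le_factorial (n + 1))) tendsto_id
  have hev2 := ht.eventually hev
  have hbig : ∀ᶠ n : ℕ in atTop, 1 < (c - 1 / 2) * ((n : ℝ) + 1) := by
    have hcpos : 0 < c - 1 / 2 := by linarith
    obtain ⟨m, hm⟩ := exists_nat_gt (1 / (c - 1 / 2))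
    filter_upwards [eventually_ge_atTop m] with n hn
    have : (m : ℝ) ≤ n := by exact_mod_cast hn
    rw [div_lt_iff₀ hcpos] at hm
    nlinarith
  obtain ⟨n0, hn0⟩ := eventually_atTop.1 (hev2.and hbig)
  refine computable_of_eventually A
    (fun n => decide ((n + 1).factorial < 2 * cnt f (n + 1).factorial)) ?_ n0 ?_
  · have hfac : Computable (fun n : ℕ => (n + 1).factorial) :=
      primrec_factorial.to_comp.comp Computable.succ
    exact (Primrec.nat_lt.decide.to_comp).comp hfac
      (Primrec.nat_mul.to_comp.comp (Computable.const 2) ((computable_cnt f hf).comp hfac))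
  intro n hn
  obtain ⟨h1, h2⟩ := hn0 n hn
  rw [decide_eq_true_iff, cnt_eq, ← hRf]
  set M := (n + 1).factorial with hM
  have hMn : (M : ℝ) = ((n : ℝ) + 1) * (n.factorial : ℝ) := by
    rw [hM, Nat.factorial_succ]; push_cast; ring
  have hfp : (0:ℝ) < n.factorial := by exact_mod_cast n.factorial_pos
  have h3 : (n.factorial : ℝ) < (c - 1 / 2) * M := by
    rw [hMn]; nlinarith
  set B : Set ℕ := {x | blk x ∈ A} with hB
  have fin : ∀ Z : Set ℕ, (Z ∩ Set.Iio M).Finite := fun Z => (Set.finite_Iio M).inter_of_right _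
  constructor
  · intro hnA
    have hsub : agree B R ∩ Set.Iio M ⊆ Set.Iio n.factorial ∪ (R ∩ Set.Iio M) := by
      rintro x ⟨hx, hxM⟩
      by_cases hxn : x < n.factorial
      · exact Or.inl hxn
      · right
        refine ⟨hx.1 ?_, hxM⟩
        change blk x ∈ A
        rw [blk_eq n x (by omega) hxM]
        exact hnA
    have h4 := (Set.ncard_le_ncard hsub ((Set.finite_Iio _).union (fin R))).trans
      (Set.ncard_union_le _ _)
    simp only [Set.ncard_Iio_nat] at h4
    have h5 : ((agree B R ∩ Set.Iio M).ncard : ℝ) ≤ n.factorial + (R ∩ Set.Iio M).ncard := by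
      exact_mod_cast h4
    have : (M : ℝ) < 2 * (R ∩ Set.Iio M).ncard := by linarith
    exact_mod_cast this
  · contrapose!
    intro hnA
    have hsub : (R ∩ Set.Iio M) ∪ (agree B R ∩ Set.Iio M) ⊆ Set.Iio M := by
      rintro x (hx | hx) <;> exact hx.2
    have hint : (R ∩ Set.Iio M) ∩ (agree B R ∩ Set.Iio M) ⊆ Set.Iio n.factorial := by
      rintro x ⟨⟨hxR, hxM⟩, hx, _⟩
      by_contra hxn
      have hxn' : n.factorial ≤ x := by simpa using hxn
      apply hnA
      have := hx.2 hxR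
      change blk x ∈ A at this
      rwa [blk_eq n x hxn' hxM] at this
    have e := Set.ncard_union_add_ncard_inter (R ∩ Set.Iio M) (agree B R ∩ Set.Iio M)
      (fin R) (fin _)
    have a1 := Set.ncard_le_ncard hsub (Set.finite_Iio M)
    have a2 := Set.ncard_le_ncard hint (Set.finite_Iio _)
    simp only [Set.ncard_Iio_nat] at a1 a2
    have h5 : ((R ∩ Set.Iio M).ncard : ℝ) + (agree B R ∩ Set.Iio M).ncard ≤ M + n.factorial := by
      exact_mod_cast (by omega : (R ∩ Set.Iio M).ncard + (agree B R ∩ Set.Iio M).ncard ≤ M + n.factorial)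
    have : 2 * ((R ∩ Set.Iio M).ncard : ℝ) ≤ M := by linarith
    exact_mod_cast this

theorem GammaM_notMem (A : Set ℕ) : GammaM A ∉ Set.Ioo (1 / 2 : ℝ) 1 := by
  rintro ⟨h1, h2⟩
  by_cases hA : ComputablePred (· ∈ A)
  · rw [GammaM_of_computable A hA] at h2
    exact lt_irrefl _ h2
  · have := GammaM_le A {x | blk x ∈ A} ⟨blk, computable_blk, fun _ => Iff.rfl⟩
    have := ccGamma_blowup A hA
    linarith

/-! ### The parity approximation -/

/-- values attained an odd number of times by `f` on `[0,N)` -/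
def oddSet (f : ℕ → ℕ) : ℕ → Finset ℕ
  | 0 => ∅
  | N + 1 => if f N ∈ oddSet f N then (oddSet f N).erase (f N) else insert (f N) (oddSet f N)

theorem card_oddSet (f : ℕ → ℕ) (N : ℕ) : (oddSet f N).card ≤ N := by
  induction N with
  | zero => simp [oddSet]
  | succ k ih =>
    rw [oddSet]
    split_ifs with h
    · exact (Finset.card_erase_le).trans (by omega)
    · rw [Finset.card_insert_of_notMem h]; omega

theorem oddSet_id (N : ℕ) : oddSet (fun n => n) N = Finset.range N := by
  induction N with
  | zero => rfl
  | succ k ih =>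
    rw [oddSet, ih]
    simp [Finset.range_add_one]

/-- computable version of membership in `oddSet` -/
def par (f : ℕ → ℕ) (m N : ℕ) : Bool :=
  Nat.rec (motive := fun _ => Bool) false (fun k ih => cond (decide (f k = m)) (!ih) ih) N

theorem par_iff (f : ℕ → ℕ) (m N : ℕ) : m ∈ oddSet f N ↔ par f m N = true := by
  induction N with
  | zero => simp [oddSet, par]
  | succ k ih =>
    have e : par f m (k + 1) = cond (decide (f k = m)) (!(par f m k)) (par f m k) := rfl
    rw [e, oddSet]
    by_cases h : f k = m
    · subst h
      split_ifs with h1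
      · simp [ih.1 h1]
      · have : par f (f k) k = false := by
          rw [← Bool.not_eq_true]; exact fun h => h1 (ih.2 h)
        simp [this]
    · have h' : m ≠ f k := fun h2 => h h2.symm
      split_ifs with h1
      · simp [h, h', ih]
      · simp [h, h', ih]

theorem computable_par (f : ℕ → ℕ) (hf : Computable f) :
    Computable (fun x => par f (f x) x) := by
  refine Computable.nat_rec (f := fun n : ℕ => n) (g := fun _ => false)
    (h := fun x q => cond (decide (f q.1 = f x)) (!q.2) q.2) Computable.id
    (Computable.const false) ?_
  have h1 : Computable (fun q : ℕ × (ℕ × Bool) => decide (f q.2.1 = f q.1)) :=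
    (Primrec.eq (α := ℕ)).decide.to_comp.comp
      (hf.comp (Computable.fst.comp Computable.snd)) (hf.comp Computable.fst)
  have h2 : Computable (fun q : ℕ × (ℕ × Bool) => q.2.2) := Computable.snd.comp Computable.snd
  exact (Computable.cond h1 (Primrec.not.to_comp.comp h2) h2).to₂

open Classical in
theorem agree_count (f : ℕ → ℕ) (A : Set ℕ) (N : ℕ) :
    2 * (agree {x | f x ∈ A} {x | f x ∈ oddSet f x} ∩ Set.Iio N).ncard + (oddSet f N).card
      = N + 2 * ((oddSet f N).filter (· ∉ A)).card := by
  induction N with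
  | zero => simp [oddSet]
  | succ k ih =>
    rw [ncard_succ]
    have hag : k ∈ agree {x | f x ∈ A} {x | f x ∈ oddSet f x} ↔ (f k ∈ A ↔ f k ∈ oddSet f k) :=
      Iff.rfl
    rw [if_congr hag rfl rfl, oddSet]
    by_cases h : f k ∈ oddSet f k
    · rw [if_pos h, Finset.filter_erase]
      have c1 := Finset.card_erase_add_one h
      by_cases hA : f k ∈ A
      · rw [Finset.erase_eq_of_notMem (s := (oddSet f k).filter (· ∉ A)) (by simp [hA])]
        simp only [h, hA, if_true]
        omega
      · have c2 := Finset.card_erase_add_one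
          (Finset.mem_filter.2 ⟨h, hA⟩ : f k ∈ (oddSet f k).filter (· ∉ A))
        simp only [h, hA, false_iff, not_true, if_false]
        omega
    · rw [if_neg h, Finset.card_insert_of_notMem h, Finset.filter_insert]
      by_cases hA : f k ∈ A
      · simp only [h, hA, not_true, if_false, iff_false]
        omega
      · rw [if_pos hA, Finset.card_insert_of_notMem (by simp [h])]
        simp only [h, hA, if_true]
        omega

open Classical in
theorem sum_ind (T : Finset ℕ) (E : ℕ → Bool) (r : ℝ) :
    ∑ i ∈ T, ((if E i then (1:ℝ) else 0) - r) = (T.filter (fun i => E i = true)).card - r * T.card := by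
  rw [Finset.sum_sub_distrib, Finset.sum_const, Finset.sum_boole, nsmul_eq_mul]
  ring

theorem arith_aux {N S a b p u q w c r ε : ℝ} (hc : 2 * c + S = N + 2 * w) (hw : w = p + q)
    (hb : u + q = b) (hp : -(ε / 2 * N) ≤ p - r * a) (hu : u - r * b ≤ ε / 2 * N)
    (k1 : 0 ≤ (1 / 2 - r) * (N - S)) (k2 : 0 ≤ (1 - 2 * r) * b) (k3 : r * S = r * a + r * b) :
    (r - ε) * N ≤ c := by
  nlinarith

open Classical in
theorem exists_GammaM (r : ℝ) (h0 : 0 ≤ r) (h1 : r ≤ 1 / 2) : ∃ A : Set ℕ, GammaM A = r := by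
  have : Nonempty {f : ℕ → ℕ // Computable f} := ⟨⟨fun n => n, Computable.id⟩⟩
  obtain ⟨e, he⟩ := exists_surjective_nat {f : ℕ → ℕ // Computable f}
  let σ : Set ℕ := {x | (e (blk x).unpair.1).1 x ≠ 1}
  let T : {f : ℕ → ℕ // Computable f} × Bool → ℕ → Finset ℕ := fun j N =>
    (oddSet j.1.1 N).filter (fun i => decide (i ∈ σ) = j.2)
  obtain ⟨E, hE⟩ := exists_random r h0 (by linarith) T
    (fun j N => (Finset.card_filter_le _ _).trans (card_oddSet _ _))
  -- discrepancy on both parts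
  have hE2 : ∀ f : ℕ → ℕ, ∀ hf : Computable f, ∀ b : Bool, ∀ ε > (0:ℝ), ∀ᶠ N : ℕ in atTop,
      |(((T (⟨f, hf⟩, b) N).filter (fun i => E i = true)).card : ℝ)
        - r * (T (⟨f, hf⟩, b) N).card| ≤ ε * N := by
    intro f hf b ε hε
    filter_upwards [hE (⟨f, hf⟩, b) ε hε] with N hN
    rwa [sum_ind] at hN
  let A : Set ℕ := {x | ¬ (x ∈ σ ↔ E x = true)}
  refine ⟨A, le_antisymm ?_ ?_⟩
  · refine (GammaM_le A A (manyOneReducible_refl _)).trans ?_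
    apply ccGamma_le
    intro R hR
    by_contra! hlt
    obtain ⟨c, hc1, hc2⟩ := exists_between hlt
    have hev := eventually_of_lt_lowerDensity _ c hc2
    have hδ : 0 < (c - r) / 4 := by linarith
    have hev1 := hE2 (fun n => n) Computable.id true _ hδ
    have hev2 := hE2 (fun n => n) Computable.id false _ hδ
    obtain ⟨g, hg, hgR⟩ := ComputablePred.computable_iff.1 hR
    obtain ⟨k, hk⟩ := he ⟨fun x => cond (g x) 1 0,
      Computable.cond hg (Computable.const 1) (Computable.const 0)⟩
    have ht : Tendsto (fun n : ℕ => (n + 1).factorial) atTop atTop :=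
      tendsto_atTop_mono (fun n => (Nat.le_succ n).trans (Nat.self_le_factorial (n + 1))) tendsto_id
    have hbig : ∀ᶠ n : ℕ in atTop, 1 < ((c - r) / 4) * ((n : ℝ) + 1) := by
      obtain ⟨m, hm⟩ := exists_nat_gt (1 / ((c - r) / 4))
      filter_upwards [eventually_ge_atTop m] with n hn
      have : (m : ℝ) ≤ n := by exact_mod_cast hn
      rw [div_lt_iff₀ hδ] at hm
      nlinarith
    obtain ⟨n0, hn0⟩ := eventually_atTop.1
      ((ht.eventually (hev.and (hev1.and hev2))).and hbig)
    obtain ⟨⟨i1, i2, i3⟩, i4⟩ := hn0 (Nat.pair k n0) (Nat.right_le_pair k n0)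
    set n := Nat.pair k n0 with hn
    set M := (n + 1).factorial with hM
    have hMn : (M : ℝ) = ((n : ℝ) + 1) * (n.factorial : ℝ) := by
      rw [hM, Nat.factorial_succ]; push_cast; ring
    have hfp : (0:ℝ) < n.factorial := by exact_mod_cast n.factorial_pos
    have h3 : (n.factorial : ℝ) < ((c - r) / 4) * M := by
      rw [hMn]; nlinarith
    have hsub : agree A R ∩ Set.Iio M ⊆
        (↑(Finset.range n.factorial ∪ (Finset.range M).filter (fun i => E i = true)) : Set ℕ) := by
      rintro x ⟨hx, hxM⟩
      have hxM' : x < M := hxM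
      by_cases hxn : x < n.factorial
      · simp [hxn]
      · have hb : blk x = n := blk_eq n x (by omega) hxM
        have hσ : x ∈ σ ↔ x ∉ R := by
          change (e (blk x).unpair.1).1 x ≠ 1 ↔ _
          have hxR : x ∈ R ↔ g x = true := iff_of_eq (congrFun hgR x)
          rw [hb, hn, Nat.unpair_pair, hk, hxR]
          change ¬ (cond (g x) 1 0 = 1) ↔ _
          by_cases hgx : g x = true <;> simp [hgx]
        have hx' : ¬ (x ∈ σ ↔ E x = true) ↔ x ∈ R := hx
        have : E x = true := by tauto
        simp [hxM', this]
    have h4 := (Set.ncard_le_ncard hsub (Finset.finite_toSet _))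
    rw [Set.ncard_coe_finset] at h4
    have h5 := h4.trans (Finset.card_union_le _ _)
    rw [Finset.card_range] at h5
    have hT : ∀ b, T (⟨fun n => n, Computable.id⟩, b) M =
        (Finset.range M).filter (fun i => decide (i ∈ σ) = b) := by
      intro b
      simp only [T, oddSet_id]
    rw [hT] at i2 i3
    have s1 : ∀ S : Finset ℕ, S.card = (S.filter (fun i => decide (i ∈ σ) = true)).card
        + (S.filter (fun i => decide (i ∈ σ) = false)).card := by
      intro S
      rw [← Finset.card_filter_add_card_filter_not (s := S) (fun i => decide (i ∈ σ) = true)]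
      simp
    have e1 := s1 (Finset.range M)
    have e2 := s1 ((Finset.range M).filter (fun i => E i = true))
    rw [Finset.filter_comm, Finset.filter_comm (p := fun i => E i = true)] at e2
    rw [Finset.card_range] at e1
    have e1' := congrArg (Nat.cast : ℕ → ℝ) e1
    have e2' := congrArg (Nat.cast : ℕ → ℝ) e2
    push_cast at e1' e2'
    have h5' : ((agree A R ∩ Set.Iio M).ncard : ℝ) ≤ n.factorial +
        (((Finset.range M).filter (fun i => E i = true)).card : ℝ) := by exact_mod_cast h5
    rw [abs_le] at i2 i3
    have hMpos : (0:ℝ) < M := by rw [hMn]; positivity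
    have e3 : r * M = r * ((Finset.range M).filter (fun i => decide (i ∈ σ) = true)).card
        + r * ((Finset.range M).filter (fun i => decide (i ∈ σ) = false)).card := by
      rw [e1']; ring
    nlinarith [i2.2, i3.2]
  · apply le_GammaM
    rintro B ⟨f, hf, hfB⟩
    have hBe : B = {x | f x ∈ A} := by
      ext x; exact hfB x
    have hR : ComputablePred (· ∈ {x | f x ∈ oddSet f x}) := by
      refine ComputablePred.computable_iff.2 ⟨_, computable_par f hf, ?_⟩
      ext x
      exact par_iff f (f x) x
    refine le_trans ?_ (le_ccGamma B _ hR)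
    rw [hBe]
    apply le_lowerDensity
    intro ε hε
    filter_upwards [hE2 f hf true (ε/2) (by linarith), hE2 f hf false (ε/2) (by linarith)]
      with N i1 i2
    have hc : 2 * (agree {x | f x ∈ A} {x | f x ∈ oddSet f x} ∩ Set.Iio N).ncard
        + (oddSet f N).card = N + 2 * ((oddSet f N).filter (· ∉ A)).card := by
      convert agree_count f A N
    have hle := card_oddSet f N
    simp only [T] at i1 i2
    set S := oddSet f N
    have s1 : S.card = (S.filter (fun i => decide (i ∈ σ) = true)).card
        + (S.filter (fun i => decide (i ∈ σ) = false)).card := by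
      rw [← Finset.card_filter_add_card_filter_not (s := S) (fun i => decide (i ∈ σ) = true)]
      simp
    have s2 : (S.filter (· ∉ A)).card =
        ((S.filter (fun i => decide (i ∈ σ) = true)).filter (fun i => E i = true)).card
        + ((S.filter (fun i => decide (i ∈ σ) = false)).filter (fun i => ¬ E i = true)).card := by
      rw [← Finset.card_filter_add_card_filter_not (s := S.filter (· ∉ A))
        (fun i => decide (i ∈ σ) = true)]
      simp only [Finset.filter_filter]
      congr 2
      · ext i
        simp only [Finset.mem_filter, A, Set.mem_ofPred_eq, decide_eq_true_eq]
        tauto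
      · ext i
        simp only [Finset.mem_filter, A, Set.mem_ofPred_eq, decide_eq_true_eq, decide_eq_false_iff_not]
        tauto
    have s3 : ((S.filter (fun i => decide (i ∈ σ) = false)).filter (fun i => E i = true)).card
        + ((S.filter (fun i => decide (i ∈ σ) = false)).filter (fun i => ¬ E i = true)).card
        = (S.filter (fun i => decide (i ∈ σ) = false)).card := by
      convert Finset.card_filter_add_card_filter_not
        (s := S.filter (fun i => decide (i ∈ σ) = false)) (fun i => E i = true)
    have hc' := congrArg (Nat.cast : ℕ → ℝ) hc
    have s1' := congrArg (Nat.cast : ℕ → ℝ) s1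
    have s2' := congrArg (Nat.cast : ℕ → ℝ) s2
    have s3' := congrArg (Nat.cast : ℕ → ℝ) s3
    have hle' : (S.card : ℝ) ≤ N := by exact_mod_cast hle
    push_cast at hc' s1' s2' s3'
    rw [abs_le] at i1 i2
    set a := ((S.filter (fun i => decide (i ∈ σ) = true)).card : ℝ)
    set b := ((S.filter (fun i => decide (i ∈ σ) = false)).card : ℝ)
    have ha : 0 ≤ a := Nat.cast_nonneg _
    have hb : 0 ≤ b := Nat.cast_nonneg _
    have k1 : 0 ≤ (1 / 2 - r) * (N - S.card) :=
      mul_nonneg (by linarith) (by linarith)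
    have k2 : 0 ≤ (1 - 2 * r) * b := mul_nonneg (by linarith) hb
    have k3 : r * S.card = r * a + r * b := by rw [s1']; ring
    exact arith_aux hc' s2' s3' i1.1 i2.2 k1 k2 k3

/-- The range of Γₘ is exactly [0,1/2] ∪ {1}. -/
theorem range_GammaM :
    (∀ r ∈ Set.Icc (0 : ℝ) (1 / 2), ∃ A : Set ℕ, GammaM A = r) ∧
    (∀ A : Set ℕ, ComputablePred (· ∈ A) → GammaM A = 1) ∧
    (∀ A : Set ℕ, GammaM A ∉ Set.Ioo (1 / 2 : ℝ) 1) :=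
  ⟨fun r hr => exists_GammaM r hr.1 hr.2, GammaM_of_computable, GammaM_notMem⟩
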